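/- For every nonzero λ ∈ k^c, right multiplication by u_λ^{a−1} induces an isomorphism of left A-modules A / A u_λ ≅ A u_λ^{a−1}. -/

import Mathlib

/-- The defining relations of the homogeneous quantum complete intersection with `c`
generators `x_i`, all exponents equal to `a`, and all commutators equal to `q`:
`x_i ^ a = 0` for all `i`, and `x_i x_j = q • (x_j x_i)` for `i < j`. -/
inductive QCIRel (k : Type) [Field k] (c a : ℕ) (q : k) :
    FreeAlgebra k (Fin c) → FreeAlgebra k (Fin c) → Prop
  | pow (i : Fin c) : QCIRel k c a q (FreeAlgebra.ι k i ^ a) 0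
  | comm (i j : Fin c) (hij : i < j) :
      QCIRel k c a q (FreeAlgebra.ι k i * FreeAlgebra.ι k j)
        (q • (FreeAlgebra.ι k j * FreeAlgebra.ι k i))

/-- The homogeneous quantum complete intersection `A = k⟨x_1,…,x_c⟩/(x_i^a, x_ix_j - q x_jx_i)`. -/
abbrev QCI (k : Type) [Field k] (c a : ℕ) (q : k) : Type := RingQuot (QCIRel k c a q)

/-- The image of the generator `x_i` in `A`. -/
noncomputable def Xgen (k : Type) [Field k] (c a : ℕ) (q : k) (i : Fin c) : QCI k c a q :=
  RingQuot.mkAlgHom k (QCIRel k c a q) (FreeAlgebra.ι k i)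

/-- The element `u_λ = λ_1 x_1 + ⋯ + λ_c x_c` of `A`. -/
noncomputable def uElt (k : Type) [Field k] (c a : ℕ) (q : k) (lam : Fin c → k) :
    QCI k c a q :=
  ∑ i, lam i • Xgen k c a q i

section
variable {k A : Type*} [Field k] [Ring A] [Algebra k A]

/-- Gaussian binomial coefficients, defined by the `q`-Pascal recursion. -/
def gaussChoose (q : k) : ℕ → ℕ → k
  | _, 0 => 1
  | 0, _ + 1 => 0
  | n + 1, i + 1 => gaussChoose q n i + q ^ (i + 1) * gaussChoose q n (i + 1)

lemma gaussChoose_zero_right (q : k) (n : ℕ) : gaussChoose q n 0 = 1 := by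
  cases n <;> rfl

lemma gaussChoose_succ_succ (q : k) (n i : ℕ) : gaussChoose q (n + 1) (i + 1) =
    gaussChoose q n i + q ^ (i + 1) * gaussChoose q n (i + 1) := rfl

lemma gaussChoose_eq_zero_of_lt (q : k) {n i : ℕ} (h : n < i) : gaussChoose q n i = 0 := by
  induction n generalizing i with
  | zero => obtain ⟨i, rfl⟩ := Nat.exists_eq_succ_of_ne_zero h.ne'; rfl
  | succ n ih =>
    obtain ⟨i, rfl⟩ := Nat.exists_eq_succ_of_ne_zero (Nat.ne_zero_of_lt h)
    rw [Nat.succ_eq_add_one, gaussChoose_succ_succ, ih (by omega), ih (by omega)]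
    simp

lemma gaussChoose_self (q : k) (n : ℕ) : gaussChoose q n n = 1 := by
  induction n with
  | zero => rfl
  | succ n ih => rw [gaussChoose_succ_succ, ih, gaussChoose_eq_zero_of_lt q n.lt_succ_self]; simp

lemma gaussChoose_succ_mul (q : k) {n i : ℕ} (h : i ≤ n) :
    (1 - q ^ (i + 1)) * gaussChoose q n (i + 1) = (1 - q ^ (n - i)) * gaussChoose q n i := by
  induction n generalizing i with
  | zero => obtain rfl : i = 0 := by omega
            simp [gaussChoose]
  | succ n ih =>
    have key : i ≤ n → (1 - q ^ (i + 1)) * gaussChoose q (n + 1) (i + 1) =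
        (1 - q ^ (n + 1)) * gaussChoose q n i := by
      intro hi
      have h2 : q ^ (i + 1) * q ^ (n - i) = q ^ (n + 1) := by
        rw [← pow_add]; congr 1; omega
      rw [gaussChoose_succ_succ]
      linear_combination q ^ (i + 1) * ih hi - gaussChoose q n i * h2
    rcases h.lt_or_eq with h' | rfl
    · rw [key (by omega)]
      cases i with
      | zero => simp [gaussChoose_zero_right]
      | succ i =>
        have h2 : q ^ (i + 1) * q ^ (n + 1 - (i + 1)) = q ^ (n + 1) := by
          rw [← pow_add]; congr 1; omega
        have h3 := ih (i := i) (by omega)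
        rw [show n - i = n + 1 - (i + 1) by omega] at h3
        rw [gaussChoose_succ_succ]
        linear_combination h3 + gaussChoose q n (i + 1) * h2
    · rw [gaussChoose_eq_zero_of_lt q (Nat.lt_succ_self _)]; simp

lemma gaussChoose_eq_zero_of_isPrimitiveRoot {q : k} {b i : ℕ} (hq : IsPrimitiveRoot q b)
    (h0 : 0 < i) (hi : i < b) : gaussChoose q b i = 0 := by
  have key : ∀ j, j < i → gaussChoose q b (j + 1) = 0 := by
    intro j hj
    induction j with
    | zero =>
      have h := gaussChoose_succ_mul q (Nat.zero_le b)
      rw [Nat.sub_zero, hq.pow_eq_one, sub_self, zero_mul] at h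
      exact (mul_eq_zero.1 h).resolve_left
        (sub_ne_zero.2 (hq.pow_ne_one_of_pos_of_lt (by omega) (by omega)).symm)
    | succ j ih =>
      have h := gaussChoose_succ_mul q (show j + 1 ≤ b by omega)
      rw [ih (by omega), mul_zero] at h
      exact (mul_eq_zero.1 h).resolve_left
        (sub_ne_zero.2 (hq.pow_ne_one_of_pos_of_lt (by omega) (by omega)).symm)
  obtain ⟨i, rfl⟩ := Nat.exists_eq_succ_of_ne_zero h0.ne'
  exact key i i.lt_succ_self

lemma mul_pow_of_qcomm {q : k} {x y : A} (h : x * y = q • (y * x)) (n : ℕ) :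
    x * y ^ n = q ^ n • (y ^ n * x) := by
  induction n with
  | zero => simp
  | succ n ih =>
    rw [pow_succ, ← mul_assoc, ih, smul_mul_assoc, mul_assoc, h, mul_smul_comm, smul_smul,
      mul_assoc, pow_succ]

lemma pow_mul_of_qcomm {q : k} {x y : A} (h : x * y = q • (y * x)) (n : ℕ) :
    x ^ n * y = q ^ n • (y * x ^ n) := by
  induction n with
  | zero => simp
  | succ n ih =>
    rw [pow_succ, mul_assoc, h, mul_smul_comm, ← mul_assoc, ih, smul_mul_assoc, smul_smul,
      mul_assoc, pow_succ']

/-- The `q`-binomial theorem. -/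
lemma add_pow_of_qcomm {q : k} {x y : A} (h : x * y = q • (y * x)) (n : ℕ) :
    (x + y) ^ n = ∑ i ∈ Finset.range (n + 1), gaussChoose q n i • (y ^ i * x ^ (n - i)) := by
  induction n with
  | zero => simp [gaussChoose]
  | succ n ih =>
    have e : ∀ i ∈ Finset.range (n + 1),
        (x + y) * (gaussChoose q n i • (y ^ i * x ^ (n - i))) =
        (q ^ i * gaussChoose q n i) • (y ^ i * x ^ (n + 1 - i)) +
          gaussChoose q n i • (y ^ (i + 1) * x ^ (n - i)) := by
      intro i hi
      have hi' : n + 1 - i = (n - i) + 1 := by have := Finset.mem_range.1 hi; omega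
      rw [mul_smul_comm, add_mul, ← mul_assoc, mul_pow_of_qcomm h, smul_add, smul_mul_assoc,
        smul_smul, ← mul_assoc, ← pow_succ', mul_assoc (y ^ i), ← pow_succ', hi', mul_comm (q ^ i)]
    rw [pow_succ', ih, Finset.mul_sum, Finset.sum_congr rfl e, Finset.sum_add_distrib,
      Finset.sum_range_succ' _ (n + 1)]
    simp only [gaussChoose_succ_succ, add_smul, Finset.sum_add_distrib, Nat.add_sub_add_right]
    rw [Finset.sum_range_succ' _ n, Finset.sum_range_succ (fun i =>
      (q ^ (i + 1) * gaussChoose q n (i + 1)) • (y ^ (i + 1) * x ^ (n - i)))]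
    simp [gaussChoose_zero_right, gaussChoose_eq_zero_of_lt q n.lt_succ_self]
    abel

lemma add_pow_of_isPrimitiveRoot {q : k} {b : ℕ} (hq : IsPrimitiveRoot q b) (hb : b ≠ 0)
    {x y : A} (h : x * y = q • (y * x)) : (x + y) ^ b = x ^ b + y ^ b := by
  obtain ⟨n, rfl⟩ := Nat.exists_eq_succ_of_ne_zero hb
  rw [add_pow_of_qcomm h, Finset.sum_range_succ, Finset.sum_range_succ', Finset.sum_eq_zero]
  · simp [gaussChoose_zero_right, gaussChoose_self]
  · intro i hi
    rw [gaussChoose_eq_zero_of_isPrimitiveRoot hq (by omega)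
      (by have := Finset.mem_range.1 hi; omega), zero_smul]

lemma add_pow_of_qcomm_of_eq [Nontrivial A] {q : k} {a b : ℕ} (ha : a ≠ 0)
    (hb : b = if ringChar k = 0 then a else a / Nat.gcd a (ringChar k))
    (hq : IsPrimitiveRoot q b) {x y : A} (h : x * y = q • (y * x)) :
    (x + y) ^ a = x ^ a + y ^ a := by
  by_cases h0 : ringChar k = 0
  · rw [if_pos h0] at hb
    subst hb
    exact add_pow_of_isPrimitiveRoot hq ha h
  rw [if_neg h0] at hb
  have hp : (ringChar k).Prime := (CharP.char_is_prime_or_zero k (ringChar k)).resolve_right h0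
  have hab : b * a.gcd (ringChar k) = a := by
    rw [hb]; exact Nat.div_mul_cancel (Nat.gcd_dvd_left _ _)
  have hb0 : b ≠ 0 := by rintro rfl; omega
  rcases (Nat.dvd_prime hp).1 (Nat.gcd_dvd_right a (ringChar k)) with h1 | h1
  · rw [h1, mul_one] at hab
    subst hab
    exact add_pow_of_isPrimitiveRoot hq hb0 h
  · rw [h1] at hab
    have : Fact (ringChar k).Prime := ⟨hp⟩
    have : CharP A (ringChar k) := charP_of_injective_algebraMap' k (A := A) (ringChar k)
    have hc : Commute (x ^ b) (y ^ b) := by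
      apply Commute.pow_right
      have := pow_mul_of_qcomm h b
      rwa [hq.pow_eq_one, one_smul] at this
    rw [← hab, pow_mul, add_pow_of_isPrimitiveRoot hq hb0 h, add_pow_char_of_commute _ hc,
      ← pow_mul, ← pow_mul]

lemma sum_pow_eq_zero_of_qcomm [Nontrivial A] {ι : Type*} [LinearOrder ι] {q : k} {a b : ℕ}
    (ha : a ≠ 0) (hb : b = if ringChar k = 0 then a else a / Nat.gcd a (ringChar k))
    (hq : IsPrimitiveRoot q b) (x : ι → A) (hx : ∀ i, x i ^ a = 0)
    (h : ∀ i j, i < j → x i * x j = q • (x j * x i)) (s : Finset ι) :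
    (∑ i ∈ s, x i) ^ a = 0 := by
  induction s using Finset.induction_on_min with
  | empty => simp [ha]
  | insert i s hi ih =>
    rw [Finset.sum_insert (fun h => lt_irrefl _ (hi i h)), add_pow_of_qcomm_of_eq ha hb hq, hx, ih,
      add_zero]
    rw [Finset.mul_sum, Finset.sum_mul, Finset.smul_sum]
    exact Finset.sum_congr rfl fun j hj => h i j (hi j hj)
end

section
variable {k A : Type*} [Field k] [Ring A] [Algebra k A]

lemma mul_list_prod_of_qcomm {y : A} (L : List A) (h : ∀ z ∈ L, ∃ s : k, y * z = s • (z * y)) :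
    ∃ s : k, y * L.prod = s • (L.prod * y) := by
  induction L with
  | nil => exact ⟨1, by simp⟩
  | cons z L ih =>
    obtain ⟨s, hs⟩ := h z (by simp)
    obtain ⟨t, ht⟩ := ih fun w hw => h w (by simp [hw])
    exact ⟨s * t, by rw [List.prod_cons, ← mul_assoc, hs, smul_mul_assoc, mul_assoc, ht,
      mul_smul_comm, smul_smul, mul_assoc]⟩

lemma list_prod_mul_of_qcomm {y : A} (L : List A) (h : ∀ z ∈ L, ∃ s : k, z * y = s • (y * z)) :
    ∃ s : k, L.prod * y = s • (y * L.prod) := by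
  induction L with
  | nil => exact ⟨1, by simp⟩
  | cons z L ih =>
    obtain ⟨s, hs⟩ := h z (by simp)
    obtain ⟨t, ht⟩ := ih fun w hw => h w (by simp [hw])
    exact ⟨t * s, by rw [List.prod_cons, mul_assoc, ht, mul_smul_comm, ← mul_assoc, hs,
      smul_mul_assoc, smul_smul, mul_assoc]⟩

variable {ι : Type*}

lemma mul_monomial_of_qcomm {x : ι → A} (h : ∀ i j, ∃ s : k, x i * x j = s • (x j * x i))
    (i : ι) (L : List ι) (e : ι → ℕ) :
    ∃ s : k, x i * (L.map fun l => x l ^ e l).prod = s • ((L.map fun l => x l ^ e l).prod * x i) := by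
  apply mul_list_prod_of_qcomm
  intro z hz
  obtain ⟨l, -, rfl⟩ := List.mem_map.1 hz
  obtain ⟨s, hs⟩ := h i l
  exact ⟨s ^ e l, mul_pow_of_qcomm hs _⟩

/-- Multiplying an ordered monomial in pairwise `q`-commuting elements by one of these elements
raises the corresponding exponent, up to a scalar. -/
lemma monomial_mul_of_qcomm [DecidableEq ι] {x : ι → A} (h : ∀ i j, ∃ s : k, x i * x j = s • (x j * x i))
    {i : ι} {L : List ι} (hL : L.Nodup) (hi : i ∈ L) (e : ι → ℕ) :
    ∃ s : k, (L.map fun l => x l ^ e l).prod * x i =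
      s • (L.map fun l => x l ^ Function.update e i (e i + 1) l).prod := by
  induction L with
  | nil => simp at hi
  | cons l L ih =>
    rw [List.nodup_cons] at hL
    by_cases hl : i = l
    · subst hl
      have hc : (L.map fun l => x l ^ Function.update e i (e i + 1) l) =
          L.map fun l => x l ^ e l := by
        apply List.map_congr_left
        intro l hl
        rw [Function.update_of_ne (by rintro rfl; exact hL.1 hl)]
      have : ∃ s : k, (L.map fun l => x l ^ e l).prod * x i =
          s • (x i * (L.map fun l => x l ^ e l).prod) := by
        apply list_prod_mul_of_qcomm
        intro z hz
        obtain ⟨m, -, rfl⟩ := List.mem_map.1 hz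
        obtain ⟨s, hs⟩ := h m i
        exact ⟨s ^ e m, pow_mul_of_qcomm hs _⟩
      obtain ⟨s, hs⟩ := this
      exact ⟨s, by
        rw [List.map_cons, List.prod_cons, List.map_cons, List.prod_cons, hc, mul_assoc, hs,
          mul_smul_comm, Function.update_self, pow_succ, mul_assoc]⟩
    · obtain ⟨s, hs⟩ := ih hL.2 ((List.mem_cons.1 hi).resolve_left hl)
      exact ⟨s, by
        rw [List.map_cons, List.prod_cons, List.map_cons, List.prod_cons, mul_assoc, hs,
          mul_smul_comm, Function.update_of_ne (Ne.symm hl)]⟩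

lemma monomial_eq_zero {x : ι → A} {i : ι} {L : List ι} (hi : i ∈ L) {e : ι → ℕ}
    (h : x i ^ e i = 0) : (L.map fun l => x l ^ e l).prod = 0 :=
  List.prod_eq_zero (List.mem_map.2 ⟨i, hi, h⟩)

variable [Fintype ι] [DecidableEq ι]

/-- If `x` is a finite family of pairwise `q`-commuting elements generating `A`, all of nilpotency
index at most `a`, then in the monomial spanning set one may replace the powers of `x j` by the
powers of a linear combination `u` of the `x i` whose coefficient at `j` does not vanish. -/
lemma span_monomial_mul_pow_eq_top {a : ℕ} (ha : 0 < a) {x : ι → A}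
    (h : ∀ i j, ∃ s : k, x i * x j = s • (x j * x i)) (hx : ∀ i, x i ^ a = 0)
    (hgen : Algebra.adjoin k (Set.range x) = ⊤) {lam : ι → k} {j : ι} (hj : lam j ≠ 0)
    (hu : (∑ i, lam i • x i) ^ a = 0) {L : List ι} (hL : L.Nodup) (hmem : ∀ i, i ∈ L ↔ i ≠ j) :
    Submodule.span k (Set.range fun e : ι → Fin a =>
      (L.map fun l => x l ^ (e l : ℕ)).prod * (∑ i, lam i • x i) ^ (e j : ℕ)) = ⊤ := by
  set u := ∑ i, lam i • x i with hu_def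
  set S := Submodule.span k (Set.range fun e : ι → Fin a =>
      (L.map fun l => x l ^ (e l : ℕ)).prod * u ^ (e j : ℕ)) with hS
  have mem : ∀ (e : ι → ℕ) (t : ℕ), (L.map fun l => x l ^ e l).prod * u ^ t ∈ S := by
    intro e t
    by_cases ht : a ≤ t
    · rw [pow_eq_zero_of_le ht hu, mul_zero]; exact S.zero_mem
    by_cases he : ∃ i ∈ L, a ≤ e i
    · obtain ⟨i, hi, hie⟩ := he
      rw [monomial_eq_zero hi (pow_eq_zero_of_le hie (hx i)), zero_mul]; exact S.zero_mem
    push Not at ht he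
    refine Submodule.subset_span ⟨fun i => ⟨(if i = j then t else e i) % a, Nat.mod_lt _ ha⟩, ?_⟩
    simp only [if_true, Nat.mod_eq_of_lt ht]
    congr 2
    apply List.map_congr_left
    intro l hl
    rw [if_neg ((hmem l).1 hl), Nat.mod_eq_of_lt (he l hl)]
  have memx : ∀ (i : ι) (e : ι → ℕ) (t : ℕ), i ≠ j →
      (L.map fun l => x l ^ e l).prod * x i * u ^ t ∈ S := by
    intro i e t hi
    obtain ⟨s, hs⟩ := monomial_mul_of_qcomm h hL ((hmem i).2 hi) e
    rw [hs, smul_mul_assoc]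
    exact S.smul_mem _ (mem _ _)
  have memj : ∀ (e : ι → ℕ) (t : ℕ), (L.map fun l => x l ^ e l).prod * x j * u ^ t ∈ S := by
    intro e t
    have hxj : x j = (lam j)⁻¹ • (u - ∑ i ∈ Finset.univ.erase j, lam i • x i) := by
      rw [hu_def, ← Finset.add_sum_erase _ _ (Finset.mem_univ j), add_sub_cancel_right, smul_smul,
        inv_mul_cancel₀ hj, one_smul]
    rw [hxj, mul_smul_comm, smul_mul_assoc, mul_sub, sub_mul, mul_assoc _ u, ← pow_succ',
      Finset.mul_sum, Finset.sum_mul]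
    refine S.smul_mem _ (S.sub_mem (mem _ _) (S.sum_mem fun i hi => ?_))
    rw [mul_smul_comm, smul_mul_assoc]
    exact S.smul_mem _ (memx i e t (Finset.ne_of_mem_erase hi))
  have stable : ∀ i, ∀ z ∈ S, x i * z ∈ S := by
    intro i z hz
    induction hz using Submodule.span_induction with
    | mem z hz =>
      obtain ⟨e, rfl⟩ := hz
      obtain ⟨s, hs⟩ := mul_monomial_of_qcomm h i L fun l => (e l : ℕ)
      simp only
      rw [← mul_assoc, hs, smul_mul_assoc]
      refine S.smul_mem _ ?_
      by_cases hi : i = j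
      · subst hi; exact memj _ _
      · exact memx i _ _ hi
    | zero => rw [mul_zero]; exact S.zero_mem
    | add y z _ _ hy hz => rw [mul_add]; exact S.add_mem hy hz
    | smul s z _ hz => rw [mul_smul_comm]; exact S.smul_mem _ hz
  have all : ∀ w : A, ∀ z ∈ S, w * z ∈ S := by
    intro w
    have hw : w ∈ Algebra.adjoin k (Set.range x) := hgen ▸ Algebra.mem_top
    induction hw using Algebra.adjoin_induction with
    | mem w hw => obtain ⟨i, rfl⟩ := hw; exact stable i
    | algebraMap r => intro z hz; rw [← Algebra.smul_def]; exact S.smul_mem _ hz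
    | add v w _ _ hv hw => intro z hz; rw [add_mul]; exact S.add_mem (hv z hz) (hw z hz)
    | mul v w _ _ hv hw => intro z hz; rw [mul_assoc]; exact hv _ (hw z hz)
  rw [eq_top_iff]
  intro w _
  have h1 := all w _ (mem 0 0)
  simpa using h1

/-- Under the hypotheses of `span_monomial_mul_pow_eq_top`, if `A` has the maximal possible
dimension then the right annihilator condition `y * u ^ (a - 1) = 0` forces `y ∈ A u`. -/
lemma exists_eq_mul_of_mul_pow_eq_zero {a : ℕ} (ha : 0 < a) {x : ι → A}
    (h : ∀ i j, ∃ s : k, x i * x j = s • (x j * x i)) (hx : ∀ i, x i ^ a = 0)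
    (hgen : Algebra.adjoin k (Set.range x) = ⊤) {lam : ι → k} (hlam : lam ≠ 0)
    (hu : (∑ i, lam i • x i) ^ a = 0)
    {v : (ι → Fin a) → A} (hv : LinearIndependent k v) {y : A}
    (hy : y * (∑ i, lam i • x i) ^ (a - 1) = 0) : ∃ z, y = z * ∑ i, lam i • x i := by
  obtain ⟨j, hj⟩ := Function.ne_iff.1 hlam
  set L := (Finset.univ.erase j).toList with hL
  have hmem : ∀ i, i ∈ L ↔ i ≠ j := by simp [hL]
  have hspan := span_monomial_mul_pow_eq_top ha h hx hgen hj hu (Finset.nodup_toList _) hmem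
  set u := ∑ i, lam i • x i with hu_def
  set w : (ι → Fin a) → A := fun e =>
      (L.map fun l => x l ^ (e l : ℕ)).prod * u ^ (e j : ℕ) with hw
  have hfin : Module.Finite k A := ⟨Submodule.fg_def.2 ⟨_, Set.finite_range w, hspan⟩⟩
  have hli : LinearIndependent k w := by
    refine linearIndependent_of_top_le_span_of_card_eq_finrank hspan.ge (le_antisymm ?_ ?_)
    · exact hv.fintype_card_le_finrank
    · have := finrank_range_le_card (R := k) w
      rwa [Set.finrank, hspan, finrank_top] at this
  obtain ⟨α, rfl⟩ : ∃ α : (ι → Fin a) → k, ∑ e, α e • w e = y :=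
    (Submodule.mem_span_range_iff_exists_fun k).1 (hspan ▸ Submodule.mem_top)
  let last : Fin a := ⟨a - 1, by omega⟩
  have hzero : ∀ e : ι → Fin a, (e j : ℕ) ≠ 0 → w e * u ^ (a - 1) = 0 := by
    intro e he
    rw [hw]
    simp only
    rw [mul_assoc, ← pow_add, pow_eq_zero_of_le (by omega) hu, mul_zero]
  have hshift : ∀ e : ι → Fin a, (e j : ℕ) = 0 →
      w e * u ^ (a - 1) = w (Function.update e j last) := by
    intro e he
    simp only [hw, he, pow_zero, mul_one, Function.update_self, last]
    congr 2
    apply List.map_congr_left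
    intro l hl
    rw [Function.update_of_ne ((hmem l).1 hl)]
  have hinj : Function.Injective fun e : {e : ι → Fin a // (e j : ℕ) = 0} =>
      Function.update e.1 j last := by
    rintro ⟨e, he⟩ ⟨e', he'⟩ hee
    ext i
    by_cases hi : i = j
    · subst hi; simp [he, he']
    · have := congrFun hee i
      simp only [Function.update_of_ne hi] at this
      simp [this]
  have hα : ∀ e : ι → Fin a, (e j : ℕ) = 0 → α e = 0 := by
    have h1 := Fintype.linearIndependent_iff.1 (hli.comp _ hinj) (fun e => α e.1) (by
      rw [← hy, Finset.sum_mul,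
        ← Finset.sum_filter_of_ne (p := fun e : ι → Fin a => (e j : ℕ) = 0)]
      · rw [Finset.sum_subtype (p := fun e : ι → Fin a => (e j : ℕ) = 0) _ (by simp)]
        refine Finset.sum_congr rfl fun e _ => ?_
        rw [smul_mul_assoc, hshift _ e.2, Function.comp]
      · intro e _ he
        by_contra h0
        exact he (by rw [smul_mul_assoc, hzero e h0, smul_zero]))
    exact fun e he => h1 ⟨e, he⟩
  refine ⟨∑ e, α e • ((L.map fun l => x l ^ (e l : ℕ)).prod * u ^ ((e j : ℕ) - 1)), ?_⟩
  rw [Finset.sum_mul]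
  refine Finset.sum_congr rfl fun e _ => ?_
  by_cases he : (e j : ℕ) = 0
  · rw [hα e he, zero_smul, zero_smul, zero_mul]
  · rw [smul_mul_assoc, mul_assoc, ← pow_succ, Nat.sub_add_cancel (by omega)]
end

section
variable (k : Type) [Field k] (c a : ℕ) (q : k)

/-- The action of the `i`-th generator on the vector space of exponent vectors. -/
noncomputable def exponentShift (i : Fin c) : Module.End k ((Fin c → ℕ) →₀ k) :=
  Finsupp.linearCombination k fun e =>
    if e i + 1 < a then
      Finsupp.single (e + Pi.single i 1) (q ^ ∑ l ∈ Finset.Ioi i, e l)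
    else 0

variable {k c a q}

lemma exponentShift_single (i : Fin c) (e : Fin c → ℕ) :
    exponentShift k c a q i (Finsupp.single e 1) = if e i + 1 < a then
      (q ^ ∑ l ∈ Finset.Ioi i, e l) • Finsupp.single (e + Pi.single i 1) (1 : k) else 0 := by
  simp [exponentShift]

lemma exponentShift_pow_single (i : Fin c) (t : ℕ) (e : Fin c → ℕ) (h : a ≤ e i + (t + 1)) :
    (exponentShift k c a q i ^ (t + 1)) (Finsupp.single e 1) = 0 := by
  induction t generalizing e with
  | zero => rw [zero_add, pow_one, exponentShift_single, if_neg (by omega)]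
  | succ t ih =>
    rw [pow_succ, Module.End.mul_apply, exponentShift_single]
    split_ifs with h'
    · rw [map_smul, ih, smul_zero]
      simp; omega
    · simp

lemma exponentShift_pow (ha : 0 < a) (i : Fin c) : exponentShift k c a q i ^ a = 0 := by
  obtain ⟨t, rfl⟩ := Nat.exists_eq_succ_of_ne_zero ha.ne'
  apply Finsupp.lhom_ext
  intro e r
  rw [← Finsupp.smul_single_one, map_smul,
    exponentShift_pow_single i t e (by omega)]
  simp

lemma exponentShift_mul (i j : Fin c) (hij : i < j) :
    exponentShift k c a q i * exponentShift k c a q j =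
      q • (exponentShift k c a q j * exponentShift k c a q i) := by
  apply Finsupp.lhom_ext
  intro e r
  rw [← Finsupp.smul_single_one, map_smul, map_smul]
  congr 1
  have h1 : ∑ l ∈ Finset.Ioi i, (e + Pi.single j 1 : Fin c → ℕ) l = (∑ l ∈ Finset.Ioi i, e l) + 1 := by
    simp [Finset.sum_add_distrib, hij]
  have h2 : ∑ l ∈ Finset.Ioi j, (e + Pi.single i 1 : Fin c → ℕ) l = ∑ l ∈ Finset.Ioi j, e l := by
    simp [Finset.sum_add_distrib, hij.le]
  have h3 : (e + Pi.single j 1 : Fin c → ℕ) i = e i := by simp [hij.ne]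
  have h4 : (e + Pi.single i 1 : Fin c → ℕ) j = e j := by simp [hij.ne']
  rw [LinearMap.smul_apply, Module.End.mul_apply, Module.End.mul_apply, exponentShift_single,
    exponentShift_single]
  split_ifs with hi hj hj
  · rw [map_smul, map_smul, exponentShift_single, exponentShift_single, h1, h2, h3, h4, if_pos hi,
      if_pos hj, smul_smul, smul_smul, smul_smul, add_right_comm]
    congr 1
    ring
  · rw [map_smul, exponentShift_single, h3, if_neg hj]; simp
  · rw [map_smul, exponentShift_single, h4, if_neg hi]; simp
  · simp

/-- The representation of `A` on the space of exponent vectors. -/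
noncomputable def exponentRep (ha : 0 < a) : QCI k c a q →ₐ[k] Module.End k ((Fin c → ℕ) →₀ k) :=
  RingQuot.liftAlgHom k ⟨FreeAlgebra.lift k (exponentShift k c a q), by
    rintro x y (i | ⟨i, j, hij⟩)
    · simp [exponentShift_pow ha]
    · simpa using exponentShift_mul i j hij⟩

lemma exponentRep_Xgen (ha : 0 < a) (i : Fin c) :
    exponentRep ha (Xgen k c a q i) = exponentShift k c a q i := by
  simp [exponentRep, Xgen]

lemma exists_exponentRep_apply_eq_single (hq : q ≠ 0) (ha : 0 < a) (n : ℕ) (e : Fin c → ℕ)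
    (hn : ∑ i, e i = n) (he : ∀ i, e i < a) :
    ∃ x : QCI k c a q, exponentRep ha x (Finsupp.single 0 1) = Finsupp.single e 1 := by
  induction n generalizing e with
  | zero =>
    obtain rfl : e = 0 := by ext i; simpa using Finset.sum_eq_zero_iff.1 hn i (Finset.mem_univ i)
    exact ⟨1, by simp⟩
  | succ n ih =>
    obtain ⟨i, -, hi⟩ := Finset.exists_ne_zero_of_sum_ne_zero (hn.trans_ne n.succ_ne_zero)
    obtain ⟨e', rfl⟩ : ∃ e' : Fin c → ℕ, e = e' + Pi.single i 1 := by
      refine ⟨e - Pi.single i 1, ?_⟩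
      ext l
      by_cases hl : l = i
      · subst hl; simp; omega
      · simp [hl]
    obtain ⟨x, hx⟩ := ih e' (by simpa [Finset.sum_add_distrib] using hn)
      (fun l => lt_of_le_of_lt (by simp) (he l))
    refine ⟨(q ^ ∑ l ∈ Finset.Ioi i, e' l)⁻¹ • (Xgen k c a q i * x), ?_⟩
    rw [map_smul, map_mul, LinearMap.smul_apply, Module.End.mul_apply, hx, exponentRep_Xgen,
      exponentShift_single, if_pos (by simpa using he i), smul_smul,
      inv_mul_cancel₀ (pow_ne_zero _ hq), one_smul]

/-- `A` contains `a ^ c` linearly independent elements. -/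
lemma exists_linearIndependent_QCI (hq : q ≠ 0) (ha : 0 < a) :
    ∃ v : (Fin c → Fin a) → QCI k c a q, LinearIndependent k v := by
  choose v hv using fun e : Fin c → Fin a =>
    exists_exponentRep_apply_eq_single hq ha _ (fun i => (e i : ℕ)) rfl (fun i => (e i).2)
  refine ⟨v, LinearIndependent.of_comp
    ((LinearMap.applyₗ (Finsupp.single 0 1)).comp (exponentRep ha).toLinearMap) ?_⟩
  have hinj : Function.Injective fun (e : Fin c → Fin a) (i : Fin c) => (e i : ℕ) := by
    intro e e' h
    ext i
    exact congrFun h i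
  convert (Finsupp.basisSingleOne (R := k) (ι := Fin c → ℕ)).linearIndependent.comp _ hinj
  ext1 e
  simpa using hv e

lemma Xgen_pow (i : Fin c) : Xgen k c a q i ^ a = 0 := by
  rw [Xgen, ← map_pow, RingQuot.mkAlgHom_rel k (QCIRel.pow i), map_zero]

lemma Xgen_mul (i j : Fin c) (hij : i < j) :
    Xgen k c a q i * Xgen k c a q j = q • (Xgen k c a q j * Xgen k c a q i) := by
  rw [Xgen, Xgen, ← map_mul, RingQuot.mkAlgHom_rel k (QCIRel.comm i j hij), map_smul, map_mul]

lemma adjoin_range_Xgen : Algebra.adjoin k (Set.range (Xgen k c a q)) = ⊤ := by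
  have h : Set.range (Xgen k c a q) =
      RingQuot.mkAlgHom k (QCIRel k c a q) '' Set.range (FreeAlgebra.ι k) := by
    rw [← Set.range_comp]; rfl
  rw [h, ← AlgHom.map_adjoin, FreeAlgebra.adjoin_range_ι, Algebra.map_top,
    AlgHom.range_eq_top]
  exact RingQuot.mkAlgHom_surjective k _
end

/-- for every nonzero `λ ∈ k^c`, right multiplication by `u_λ^{a-1}` induces
an isomorphism of left `A`-modules `A / A u_λ ≅ A u_λ^{a-1}`. -/
theorem statement8 (k : Type) [Field k] [IsAlgClosed k] (c a : ℕ) (hc : 2 ≤ c) (ha : 2 ≤ a)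
    (b : ℕ) (hb : b = if ringChar k = 0 then a else a / Nat.gcd a (ringChar k))
    (q : k) (hq : IsPrimitiveRoot q b) (lam : Fin c → k) (hlam : lam ≠ 0) :
    letI A := QCI k c a q
    letI u := uElt k c a q lam
    ∃ e : (A ⧸ LinearMap.range (LinearMap.toSpanSingleton A A u)) ≃ₗ[A]
        LinearMap.range (LinearMap.toSpanSingleton A A (u ^ (a - 1))),
      ∀ x : A, (e (Submodule.Quotient.mk x) : A) = x * u ^ (a - 1) := by
  have hb0 : b ≠ 0 := by
    rw [hb]
    split_ifs
    · omega
    · exact (Nat.div_pos (Nat.le_of_dvd (by omega) (Nat.gcd_dvd_left _ _))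
        (Nat.gcd_pos_of_pos_left _ (by omega))).ne'
  have hq0 : q ≠ 0 := (hq.isUnit hb0).ne_zero
  have ha0 : 0 < a := by omega
  obtain ⟨v, hv⟩ := exists_linearIndependent_QCI (c := c) hq0 ha0
  have : Nontrivial (QCI k c a q) := ⟨v fun _ => ⟨0, ha0⟩, 0, hv.ne_zero _⟩
  have hu : uElt k c a q lam ^ a = 0 := by
    refine sum_pow_eq_zero_of_qcomm ha0.ne' hb hq _ (fun i => ?_) (fun i j hij => ?_) _
    · rw [smul_pow, Xgen_pow, smul_zero]
    · rw [smul_mul_smul_comm, smul_mul_smul_comm, Xgen_mul i j hij, smul_smul, smul_smul]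
      congr 1
      ring
  have hcomm : ∀ i j, ∃ s : k, Xgen k c a q i * Xgen k c a q j =
      s • (Xgen k c a q j * Xgen k c a q i) := by
    intro i j
    rcases lt_trichotomy i j with h | rfl | h
    · exact ⟨q, Xgen_mul i j h⟩
    · exact ⟨1, (one_smul _ _).symm⟩
    · exact ⟨q⁻¹, by rw [Xgen_mul j i h, smul_smul, inv_mul_cancel₀ hq0, one_smul]⟩
  have hker : LinearMap.range (LinearMap.toSpanSingleton (QCI k c a q) _ (uElt k c a q lam)) =
      LinearMap.ker (LinearMap.toSpanSingleton (QCI k c a q) _ (uElt k c a q lam ^ (a - 1))) := by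
    ext y
    simp only [LinearMap.mem_range, LinearMap.mem_ker, LinearMap.toSpanSingleton_apply, smul_eq_mul]
    constructor
    · rintro ⟨z, rfl⟩
      rw [mul_assoc, ← pow_succ', Nat.sub_add_cancel ha0, hu, mul_zero]
    · intro hy
      obtain ⟨z, hz⟩ := exists_eq_mul_of_mul_pow_eq_zero ha0 hcomm Xgen_pow adjoin_range_Xgen
        hlam hu hv hy
      exact ⟨z, hz.symm⟩
  exact ⟨(Submodule.quotEquivOfEq _ _ hker).trans (LinearMap.quotKerEquivRange _), fun x => rfl⟩
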